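/- (Tightness of the RDK bound.) Under the setting of the randomized double Kaczmarz algorithm, suppose in addition that all nonzero singular values of A are equal, i.e. there is σ > 0 with AAᵀA = σ²A, and set ρ = 1 − σ²/‖A‖_F². Let c ∈ range(Aᵀ), z⁰ ∈ b + range(A), x⁰ ∈ ℝⁿ, let z* be the unique vector with Aᵀz* = c and z⁰ − z* ∈ range(A), and let x* be the unique vector with Ax* = b − z* and x⁰ − x* ∈ range(Aᵀ). Then for every k ≥ 1, E[‖x^k − x*‖₂²] = (kρ^k/‖A‖_F²)‖z⁰ − z*‖₂² + ρ^k‖x⁰ − x*‖₂² exactly. -/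

import Mathlib

open Matrix

/-- Squared Euclidean norm. -/
def sqnorm {n : ℕ} (u : Fin n → ℝ) : ℝ := ∑ i, (u i) ^ 2

/-- Squared Frobenius norm of a matrix. -/
def frob2 {m n : ℕ} (A : Matrix (Fin m) (Fin n) ℝ) : ℝ := ∑ i, ∑ j, (A i j) ^ 2

/-- Squared Euclidean norm of the `i`-th row of `A`. -/
def rowNorm2 {m n : ℕ} (A : Matrix (Fin m) (Fin n) ℝ) (i : Fin m) : ℝ := ∑ j, (A i j) ^ 2

/-- Squared Euclidean norm of the `j`-th column of `A`. -/
def colNorm2 {m n : ℕ} (A : Matrix (Fin m) (Fin n) ℝ) (j : Fin n) : ℝ := ∑ i, (A i j) ^ 2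

/-- One step of the randomized double Kaczmarz algorithm for `AᵀAx = Aᵀb − c`:
given the index pair `(j, i)`, first update `z` by a Kaczmarz step on `Aᵀz = c` with
column `j`, then update `x` by a Kaczmarz step on `Ax = b − z` with row `i`. -/
noncomputable def rdkStep {m n : ℕ} (A : Matrix (Fin m) (Fin n) ℝ) (b : Fin m → ℝ)
    (c : Fin n → ℝ) (p : Fin n × Fin m) (s : (Fin m → ℝ) × (Fin n → ℝ)) :
    (Fin m → ℝ) × (Fin n → ℝ) :=
  let z := s.1 - ((Aᵀ.mulVec s.1 p.1 - c p.1) / colNorm2 A p.1) • (fun i => A i p.1)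
  (z, s.2 - ((A.mulVec s.2 p.2 - b p.2 + z p.2) / rowNorm2 A p.2) • (fun j => A p.2 j))

lemma sqnorm_eq_dotProduct {n : ℕ} (u : Fin n → ℝ) : sqnorm u = u ⬝ᵥ u := by
  simp [sqnorm, dotProduct, sq]

lemma sqnorm_ne_zero {n : ℕ} {u : Fin n → ℝ} (hu : u ≠ 0) : sqnorm u ≠ 0 := by
  rw [sqnorm_eq_dotProduct]
  exact fun h => hu (dotProduct_self_eq_zero.mp h)

lemma sqnorm_sub_smul {n : ℕ} (v a : Fin n → ℝ) (e : ℝ) (ha : sqnorm a ≠ 0) :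
    sqnorm (v - ((a ⬝ᵥ v + e) / sqnorm a) • a)
      = sqnorm v - (a ⬝ᵥ v) ^ 2 / sqnorm a + e ^ 2 / sqnorm a := by
  have h : sqnorm (v - ((a ⬝ᵥ v + e) / sqnorm a) • a)
      = sqnorm v - 2 * ((a ⬝ᵥ v + e) / sqnorm a) * (a ⬝ᵥ v)
        + ((a ⬝ᵥ v + e) / sqnorm a) ^ 2 * sqnorm a := by
    generalize (a ⬝ᵥ v + e) / sqnorm a = t
    simp only [sqnorm_eq_dotProduct, sub_dotProduct, dotProduct_sub, smul_dotProduct,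
      dotProduct_smul, smul_eq_mul, dotProduct_comm v a]
    ring
  rw [h]
  field_simp
  ring

/-- Expected squared error after a Kaczmarz step with a perturbed right-hand side. -/
lemma sum_rowNorm2_mul_sqnorm {m n : ℕ} (A : Matrix (Fin m) (Fin n) ℝ) (hF : frob2 A ≠ 0)
    (hrows : ∀ i, (fun j => A i j) ≠ 0) (v : Fin n → ℝ) (e : Fin m → ℝ) :
    ∑ i, rowNorm2 A i / frob2 A *
        sqnorm (v - ((A.mulVec v i + e i) / rowNorm2 A i) • (fun j => A i j))
      = sqnorm v - sqnorm (A.mulVec v) / frob2 A + sqnorm e / frob2 A := by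
  have h : ∀ i, rowNorm2 A i / frob2 A *
        sqnorm (v - ((A.mulVec v i + e i) / rowNorm2 A i) • (fun j => A i j))
      = rowNorm2 A i * (sqnorm v / frob2 A) - (A.mulVec v i) ^ 2 / frob2 A
        + (e i) ^ 2 / frob2 A := by
    intro i
    have hi : rowNorm2 A i ≠ 0 := sqnorm_ne_zero (hrows i)
    have hs : sqnorm (v - ((A.mulVec v i + e i) / rowNorm2 A i) • (fun j => A i j))
        = sqnorm v - (A.mulVec v i) ^ 2 / rowNorm2 A i + (e i) ^ 2 / rowNorm2 A i :=
      sqnorm_sub_smul v (fun j => A i j) (e i) hi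
    rw [hs]
    field_simp
  rw [Finset.sum_congr rfl fun i _ => h i, Finset.sum_add_distrib, Finset.sum_sub_distrib,
    ← Finset.sum_mul, ← Finset.sum_div, ← Finset.sum_div]
  have hr : ∑ i, rowNorm2 A i = frob2 A := rfl
  rw [hr, mul_div_cancel₀ _ hF]
  rfl

lemma frob2_transpose {m n : ℕ} (A : Matrix (Fin m) (Fin n) ℝ) : frob2 Aᵀ = frob2 A :=
  Finset.sum_comm

lemma frob2_ne_zero {m n : ℕ} {A : Matrix (Fin m) (Fin n) ℝ} (hA : A ≠ 0) : frob2 A ≠ 0 := by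
  contrapose! hA
  ext i j
  have h := (Finset.sum_eq_zero_iff_of_nonneg fun i _ =>
    Finset.sum_nonneg fun j _ => sq_nonneg (A i j)).mp hA i (Finset.mem_univ i)
  simpa using (Finset.sum_eq_zero_iff_of_nonneg fun j _ => sq_nonneg (A i j)).mp h j
    (Finset.mem_univ j)

lemma sqnorm_mulVec_of_mem_range {m n : ℕ} {A : Matrix (Fin m) (Fin n) ℝ} {s : ℝ}
    (h : A * Aᵀ * A = s • A) {u : Fin m → ℝ} (hu : u ∈ Set.range A.mulVec) :
    sqnorm (Aᵀ.mulVec u) = s * sqnorm u := by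
  obtain ⟨w, rfl⟩ := hu
  have h1 : A.mulVec (Aᵀ.mulVec (A.mulVec w)) = s • A.mulVec w := by
    rw [mulVec_mulVec, mulVec_mulVec, h, smul_mulVec]
  rw [sqnorm_eq_dotProduct, sqnorm_eq_dotProduct, dotProduct_mulVec, vecMul_transpose, h1,
    smul_dotProduct, smul_eq_mul]

lemma sub_smul_col_mem_range {m n : ℕ} (A : Matrix (Fin m) (Fin n) ℝ) {u : Fin m → ℝ}
    (hu : u ∈ Set.range A.mulVec) (t : ℝ) (j : Fin n) :
    u - t • (fun i => A i j) ∈ Set.range A.mulVec := by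
  obtain ⟨w, rfl⟩ := hu
  refine ⟨w - t • Pi.single j 1, ?_⟩
  rw [mulVec_sub, mulVec_smul, mulVec_single_one]
  rfl

lemma rdkStep_fst_sub {m n : ℕ} (A : Matrix (Fin m) (Fin n) ℝ) (b : Fin m → ℝ) {c : Fin n → ℝ}
    {zs : Fin m → ℝ} (hzs : Aᵀ.mulVec zs = c) (p : Fin n × Fin m)
    (s : (Fin m → ℝ) × (Fin n → ℝ)) :
    (rdkStep A b c p s).1 - zs = (s.1 - zs) -
      ((Aᵀ.mulVec (s.1 - zs) p.1) / colNorm2 A p.1) • (fun i => A i p.1) := by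
  rw [mulVec_sub, hzs]
  simp only [rdkStep, Pi.sub_apply]
  abel

lemma rdkStep_snd_sub {m n : ℕ} (A : Matrix (Fin m) (Fin n) ℝ) {b : Fin m → ℝ} (c : Fin n → ℝ)
    {zs : Fin m → ℝ} {xs : Fin n → ℝ} (hxs : A.mulVec xs = b - zs) (p : Fin n × Fin m)
    (s : (Fin m → ℝ) × (Fin n → ℝ)) :
    (rdkStep A b c p s).2 - xs = (s.2 - xs) -
      ((A.mulVec (s.2 - xs) p.2 + ((rdkStep A b c p s).1 - zs) p.2) / rowNorm2 A p.2) •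
        (fun j => A p.2 j) := by
  have h : A.mulVec (s.2 - xs) p.2 + ((rdkStep A b c p s).1 - zs) p.2
      = A.mulVec s.2 p.2 - b p.2 + (rdkStep A b c p s).1 p.2 := by
    rw [mulVec_sub, hxs]
    simp only [Pi.sub_apply]
    ring
  rw [h]
  simp only [rdkStep]
  abel

/-- Expected value, after one RDK step, of a weighted sum of the two squared errors. -/
lemma sum_rdkStep {m n : ℕ} {A : Matrix (Fin m) (Fin n) ℝ} (hA : A ≠ 0)
    (hrows : ∀ i, (fun j => A i j) ≠ 0) (hcols : ∀ j, (fun i => A i j) ≠ 0)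
    {τ : ℝ} (hsing : A * Aᵀ * A = τ • A) {b : Fin m → ℝ} {c : Fin n → ℝ}
    {zs : Fin m → ℝ} (hzs : Aᵀ.mulVec zs = c) {xs : Fin n → ℝ} (hxs : A.mulVec xs = b - zs)
    {z : Fin m → ℝ} (hz : z - zs ∈ Set.range A.mulVec)
    {x : Fin n → ℝ} (hx : x - xs ∈ Set.range (Aᵀ.mulVec)) (α β : ℝ) :
    ∑ q : Fin n × Fin m, (colNorm2 A q.1 / frob2 A) * (rowNorm2 A q.2 / frob2 A) *
        (α * sqnorm ((rdkStep A b c q (z, x)).1 - zs)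
          + β * sqnorm ((rdkStep A b c q (z, x)).2 - xs))
      = (1 - τ / frob2 A) * ((α + β / frob2 A) * sqnorm (z - zs) + β * sqnorm (x - xs)) := by
  have hF := frob2_ne_zero hA
  have hsing' : Aᵀ * Aᵀᵀ * Aᵀ = τ • Aᵀ := by
    have := congrArg transpose hsing
    simpa [transpose_mul, Matrix.mul_assoc] using this
  have hrow : ∑ i, rowNorm2 A i = frob2 A := rfl
  have hcol : ∑ j, colNorm2 A j = frob2 A := frob2_transpose A
  set Z : Fin n → Fin m → ℝ := fun j =>
    (z - zs) - ((Aᵀ.mulVec (z - zs) j) / colNorm2 A j) • (fun i => A i j)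
  have hZE : ∑ j, colNorm2 A j / frob2 A * sqnorm (Z j)
      = (1 - τ / frob2 A) * sqnorm (z - zs) := by
    have h := sum_rowNorm2_mul_sqnorm Aᵀ (by rwa [frob2_transpose]) hcols (z - zs) 0
    rw [frob2_transpose, sqnorm_mulVec_of_mem_range hsing hz] at h
    simp only [Pi.zero_apply, add_zero] at h
    refine h.trans ?_
    simp [sqnorm]
    ring
  have hXE : ∀ j, ∑ i, rowNorm2 A i / frob2 A *
        (α * sqnorm ((rdkStep A b c (j, i) (z, x)).1 - zs)
          + β * sqnorm ((rdkStep A b c (j, i) (z, x)).2 - xs))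
      = (α + β / frob2 A) * sqnorm (Z j) + β * (1 - τ / frob2 A) * sqnorm (x - xs) := by
    intro j
    have h := sum_rowNorm2_mul_sqnorm A hF hrows (x - xs) (Z j)
    have hsx := sqnorm_mulVec_of_mem_range hsing' hx
    rw [transpose_transpose] at hsx
    rw [hsx] at h
    have h1 : ∀ i, (rdkStep A b c (j, i) (z, x)).1 - zs = Z j := fun i =>
      rdkStep_fst_sub A b hzs (j, i) (z, x)
    simp only [rdkStep_snd_sub A c hxs, h1, mul_add, Finset.sum_add_distrib, mul_left_comm _ β,
      ← Finset.mul_sum, ← Finset.sum_mul, ← Finset.sum_div, hrow, h, div_self hF]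
    ring
  rw [Fintype.sum_prod_type]
  simp only [mul_assoc, ← Finset.mul_sum]
  simp only [hXE]
  simp only [mul_add, Finset.sum_add_distrib, mul_left_comm _ (α + β / frob2 A),
    ← Finset.mul_sum, hZE, ← Finset.sum_mul, ← Finset.sum_div, hcol, div_self hF]
  ring

/-- The expected squared error of the RDK iterates, for every number of steps. -/
lemma sum_foldl_rdkStep {m n : ℕ} {A : Matrix (Fin m) (Fin n) ℝ} (hA : A ≠ 0)
    (hrows : ∀ i, (fun j => A i j) ≠ 0) (hcols : ∀ j, (fun i => A i j) ≠ 0)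
    {τ : ℝ} (hsing : A * Aᵀ * A = τ • A) {b : Fin m → ℝ} {c : Fin n → ℝ}
    {zs : Fin m → ℝ} (hzs : Aᵀ.mulVec zs = c) {xs : Fin n → ℝ} (hxs : A.mulVec xs = b - zs)
    (k : ℕ) (z : Fin m → ℝ) (hz : z - zs ∈ Set.range A.mulVec)
    (x : Fin n → ℝ) (hx : x - xs ∈ Set.range (Aᵀ.mulVec)) :
    ∑ p : Fin k → Fin n × Fin m,
        (∏ t, (colNorm2 A (p t).1 / frob2 A) * (rowNorm2 A (p t).2 / frob2 A)) *
          sqnorm (((List.ofFn p).foldl (fun s q => rdkStep A b c q s) (z, x)).2 - xs)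
      = (k : ℝ) * (1 - τ / frob2 A) ^ k / frob2 A * sqnorm (z - zs)
        + (1 - τ / frob2 A) ^ k * sqnorm (x - xs) := by
  induction k generalizing z x with
  | zero => simp
  | succ k ih =>
    rw [← (Fin.consEquiv fun _ => Fin n × Fin m).sum_comp, Fintype.sum_prod_type]
    have hstep : ∀ q : Fin n × Fin m,
        ∑ p : Fin k → Fin n × Fin m,
          (∏ t, (colNorm2 A (p t).1 / frob2 A) * (rowNorm2 A (p t).2 / frob2 A)) *
            sqnorm (((List.ofFn p).foldl (fun s q => rdkStep A b c q s)
              (rdkStep A b c q (z, x))).2 - xs)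
        = (k : ℝ) * (1 - τ / frob2 A) ^ k / frob2 A * sqnorm ((rdkStep A b c q (z, x)).1 - zs)
          + (1 - τ / frob2 A) ^ k * sqnorm ((rdkStep A b c q (z, x)).2 - xs) := by
      intro q
      refine ih (rdkStep A b c q (z, x)).1 ?_ (rdkStep A b c q (z, x)).2 ?_
      · rw [rdkStep_fst_sub A b hzs]
        exact sub_smul_col_mem_range A hz _ _
      · rw [rdkStep_snd_sub A c hxs]
        exact sub_smul_col_mem_range Aᵀ hx _ _
    simp only [Fin.consEquiv_apply, Fin.prod_univ_succ, Fin.cons_zero, Fin.cons_succ,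
      List.ofFn_succ, List.foldl_cons, mul_assoc (_ * _) (Finset.prod _ _), ← Finset.mul_sum,
      hstep]
    rw [sum_rdkStep hA hrows hcols hsing hzs hxs hz hx]
    push_cast
    ring

/-- Tightness of the RDK bound: if all nonzero singular values of `A` are equal
(`AAᵀA = σ²A` with `σ > 0`, `ρ = 1 − σ²/‖A‖_F²`), then
`E[‖x^k − x*‖₂²] = (kρ^k/‖A‖_F²)‖z⁰ − z*‖₂² + ρ^k‖x⁰ − x*‖₂²` exactly. -/
theorem stmt10 {m n : ℕ} (A : Matrix (Fin m) (Fin n) ℝ) (hA : A ≠ 0)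
    (hrows : ∀ i, (fun j => A i j) ≠ 0) (hcols : ∀ j, (fun i => A i j) ≠ 0)
    (σ : ℝ) (hσ : 0 < σ) (hsing : A * Aᵀ * A = (σ ^ 2) • A)
    (b : Fin m → ℝ) (c : Fin n → ℝ) (hc : c ∈ Set.range (Aᵀ.mulVec))
    (z0 : Fin m → ℝ) (hz0 : z0 - b ∈ Set.range A.mulVec) (x0 : Fin n → ℝ)
    (zs : Fin m → ℝ) (hzs : Aᵀ.mulVec zs = c) (hz0zs : z0 - zs ∈ Set.range A.mulVec)
    (xs : Fin n → ℝ) (hxs : A.mulVec xs = b - zs) (hx0xs : x0 - xs ∈ Set.range (Aᵀ.mulVec))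
    (k : ℕ) (hk : 1 ≤ k) :
    ∑ p : Fin k → Fin n × Fin m,
        (∏ t, (colNorm2 A (p t).1 / frob2 A) * (rowNorm2 A (p t).2 / frob2 A)) *
          sqnorm (((List.ofFn p).foldl (fun s q => rdkStep A b c q s) (z0, x0)).2 - xs)
      = (k : ℝ) * (1 - σ ^ 2 / frob2 A) ^ k / frob2 A * sqnorm (z0 - zs)
        + (1 - σ ^ 2 / frob2 A) ^ k * sqnorm (x0 - xs) := by
  exact sum_foldl_rdkStep hA hrows hcols hsing hzs hxs k z0 hz0zs x0 hx0xs
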